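/- Let n be a positive integer and let A, B, C be n×n complex matrices. If A belongs to the bundle of B and B belongs to the closure (in the usual topology of the space of n×n complex matrices) of the bundle of C, then A belongs to the closure of the bundle of C. -/

import Mathlib

open Matrix

/-- `M` and `N` have the same Jordan type: there is a bijection `φ` between their sets of
eigenvalues such that `rank ((M - μ•1)^k) = rank ((N - φ μ • 1)^k)` for every eigenvalue `μ`
of `M` and every natural number `k`. -/
def SameJordanType (n : ℕ) (M N : Matrix (Fin n) (Fin n) ℂ) : Prop :=
  ∃ φ : spectrum ℂ M ≃ spectrum ℂ N,
    ∀ (μ : spectrum ℂ M) (k : ℕ),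
      ((M - (μ : ℂ) • (1 : Matrix (Fin n) (Fin n) ℂ)) ^ k).rank =
        ((N - ((φ μ : ℂ)) • (1 : Matrix (Fin n) (Fin n) ℂ)) ^ k).rank

/-- The bundle of a matrix `C`: all matrices with the same Jordan canonical form as `C`
up to the values of the distinct eigenvalues. -/
def bundle (n : ℕ) (C : Matrix (Fin n) (Fin n) ℂ) : Set (Matrix (Fin n) (Fin n) ℂ) :=
  {M | SameJordanType n M C}

/-- An isomorphism between the ranges of two endomorphisms that intertwines their restrictions
extends to an intertwining isomorphism of the whole spaces. -/
theorem exists_intertwining_equiv_of_range {K V V' : Type*} [Field K]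
    [AddCommGroup V] [Module K V] [FiniteDimensional K V]
    [AddCommGroup V'] [Module K V'] [FiniteDimensional K V']
    (hdim : Module.finrank K V = Module.finrank K V')
    (N : V →ₗ[K] V) (N' : V' →ₗ[K] V') (f : LinearMap.range N ≃ₗ[K] LinearMap.range N')
    (hf : ∀ w : LinearMap.range N, (f (N.rangeRestrict w) : V') = N' (f w)) :
    ∃ g : V ≃ₗ[K] V', ∀ v, g (N v) = N' (g v) := by
  have hker : Module.finrank K (LinearMap.ker N) = Module.finrank K (LinearMap.ker N') := by
    have h1 := N.finrank_range_add_finrank_ker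
    have h2 := N'.finrank_range_add_finrank_ker
    have h3 := f.finrank_eq
    omega
  have hinf : Module.finrank K (LinearMap.ker N ⊓ LinearMap.range N : Submodule K V) =
      Module.finrank K (LinearMap.ker N' ⊓ LinearMap.range N' : Submodule K V') := by
    rw [inf_comm, inf_comm (LinearMap.ker N'), ← Submodule.map_comap_subtype,
      ← Submodule.map_comap_subtype, Submodule.finrank_map_subtype_eq,
      Submodule.finrank_map_subtype_eq, ← f.finrank_map_eq]
    refine congrArg (fun S : Submodule K (LinearMap.range N') => Module.finrank K S) ?_
    ext x
    constructor
    · rintro ⟨w, hw, rfl⟩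
      have : N (w : V) = 0 := hw
      have h0 : N.rangeRestrict (w : V) = 0 := Subtype.ext this
      have := hf w
      rw [h0] at this
      simpa using this.symm
    · intro hx
      refine ⟨f.symm x, ?_, by simp⟩
      have hx' : N' (x : V') = 0 := hx
      have := hf (f.symm x)
      rw [f.apply_symm_apply, hx'] at this
      have h0 : N.rangeRestrict (f.symm x : V) = 0 := by
        apply f.injective
        rw [map_zero]
        exact Subtype.ext this
      exact congrArg Subtype.val h0
  obtain ⟨L, hL, hL'⟩ := IsModularLattice.exists_disjoint_and_sup_eq
    (inf_le_left : LinearMap.ker N ⊓ LinearMap.range N ≤ LinearMap.ker N)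
  obtain ⟨M, hM, hM'⟩ := IsModularLattice.exists_disjoint_and_sup_eq
    (inf_le_left : LinearMap.ker N' ⊓ LinearMap.range N' ≤ LinearMap.ker N')
  have hLK : L ≤ LinearMap.ker N := hL' ▸ le_sup_right
  have hMK : M ≤ LinearMap.ker N' := hM' ▸ le_sup_right
  have hdL : Module.finrank K L = Module.finrank K M := by
    have h1 := Submodule.finrank_sup_add_finrank_inf_eq (LinearMap.ker N ⊓ LinearMap.range N) L
    have h2 := Submodule.finrank_sup_add_finrank_inf_eq (LinearMap.ker N' ⊓ LinearMap.range N') M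
    rw [hL', hL.eq_bot, finrank_bot] at h1
    rw [hM', hM.eq_bot, finrank_bot] at h2
    omega
  have hLW : Disjoint (LinearMap.range N) L := by
    rw [Submodule.disjoint_def] at hL ⊢
    exact fun x hx hxL => hL x ⟨hLK hxL, hx⟩ hxL
  have hMW : Disjoint (LinearMap.range N') M := by
    rw [Submodule.disjoint_def] at hM ⊢
    exact fun x hx hxM => hM x ⟨hMK hxM, hx⟩ hxM
  obtain ⟨h, hhW, hhN⟩ : ∃ h : V →ₗ[K] V', (∀ w : LinearMap.range N, h w = f w) ∧
      ∀ v, N' (h v) = f (N.rangeRestrict v) := by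
    obtain ⟨U, hU⟩ := Submodule.exists_isCompl (LinearMap.range N)
    obtain ⟨s, hs⟩ := N'.rangeRestrict.exists_rightInverse_of_surjective N'.range_rangeRestrict
    have hs' : ∀ y, N' (s y) = y := fun y => congrArg Subtype.val (LinearMap.congr_fun hs y)
    let h := LinearMap.ofIsCompl hU ((LinearMap.range N').subtype ∘ₗ f.toLinearMap)
      ((s ∘ₗ f.toLinearMap ∘ₗ N.rangeRestrict) ∘ₗ U.subtype)
    have hhW : ∀ w : LinearMap.range N, h w = f w := fun w => by simp [h]
    have hhU : ∀ u : U, h u = s (f (N.rangeRestrict u)) := fun u => by simp [h]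
    refine ⟨h, hhW, fun v => ?_⟩
    obtain ⟨w, hw, u, hu, rfl⟩ := Submodule.mem_sup.1 (hU.sup_eq_top ▸ Submodule.mem_top : v ∈ _)
    rw [map_add, map_add, map_add, map_add, hhW ⟨w, hw⟩, hhU ⟨u, hu⟩, hs', ← hf ⟨w, hw⟩]
    rfl
  obtain ⟨Q, hWQ, hQ⟩ := hLW.exists_isCompl
  let e : L ≃ₗ[K] M := LinearEquiv.ofFinrankEq _ _ hdL
  let g := LinearMap.ofIsCompl hQ (h ∘ₗ Q.subtype) (M.subtype ∘ₗ e.toLinearMap)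
  have hgQ : ∀ x ∈ Q, g x = h x := fun x hx => by
    simpa [g] using LinearMap.ofIsCompl_apply_left hQ (φ := h ∘ₗ Q.subtype)
      (ψ := M.subtype ∘ₗ e.toLinearMap) ⟨x, hx⟩
  have hgL : ∀ x : L, g x = e x := fun x => by simp [g]
  have hgN : ∀ v, N' (g v) = f (N.rangeRestrict v) := by
    intro v
    obtain ⟨w, hw, u, hu, rfl⟩ := Submodule.mem_sup.1 (hQ.sup_eq_top ▸ Submodule.mem_top : v ∈ _)
    have h1 : N.rangeRestrict u = 0 := Subtype.ext (hLK hu)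
    have h2 : N' (e ⟨u, hu⟩ : V') = 0 := hMK (e ⟨u, hu⟩).2
    rw [map_add, map_add, map_add, hgQ w hw, hgL ⟨u, hu⟩, hhN, h1, h2, add_zero, add_zero]
  have hgW : ∀ w : LinearMap.range N, g w = f w := fun w => by
    rw [hgQ _ (hWQ w.2), hhW]
  have hinj : Function.Injective g := by
    rw [← LinearMap.ker_eq_bot, LinearMap.ker_eq_bot']
    intro v hv
    have h0 : f (N.rangeRestrict v) = 0 := Subtype.ext (by rw [← hgN, hv, map_zero]; rfl)
    have h1 : N v = 0 := congrArg Subtype.val ((map_eq_zero_iff f f.injective).1 h0)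
    obtain ⟨w, hw, u, hu, rfl⟩ := Submodule.mem_sup.1
      (hL'.symm ▸ h1 : v ∈ (LinearMap.ker N ⊓ LinearMap.range N) ⊔ L)
    rw [map_add, hgW ⟨w, hw.2⟩, hgL ⟨u, hu⟩] at hv
    have h2 : ((f ⟨w, hw.2⟩ : LinearMap.range N') : V') = 0 := by
      refine Submodule.disjoint_def.1 hMW _ (f _).2 ?_
      rw [eq_neg_of_add_eq_zero_left hv]
      exact M.neg_mem (e _).2
    rw [h2, zero_add] at hv
    have h3 : w = 0 := congrArg Subtype.val ((map_eq_zero_iff f f.injective).1 (Subtype.ext h2))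
    have h4 : u = 0 := congrArg Subtype.val ((map_eq_zero_iff e e.injective).1 (Subtype.ext hv))
    rw [h3, h4, add_zero]
  refine ⟨LinearEquiv.ofInjectiveOfFinrankEq g hinj hdim, fun v => ?_⟩
  change g (N v) = N' (g v)
  rw [hgN]
  exact hgW (N.rangeRestrict v)

open Polynomial in
/-- The restriction of `a` to the range of `q(a)`, whose polynomials `p` have the rank of
`(p * q)(a)`. -/
theorem exists_restriction_range_aeval {K V : Type*} [Field K]
    [AddCommGroup V] [Module K V] [FiniteDimensional K V] (a : Module.End K V) (q : K[X]) :
    ∃ r : Module.End K (LinearMap.range (aeval a q)), (∀ w, (r w : V) = a w) ∧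
      ∀ p : K[X], Module.finrank K (LinearMap.range (aeval r p)) =
        Module.finrank K (LinearMap.range (aeval a (p * q))) := by
  have hinv : ∀ x ∈ LinearMap.range (aeval a q), a x ∈ LinearMap.range (aeval a q) := by
    rintro _ ⟨y, rfl⟩
    refine ⟨a y, ?_⟩
    have h : aeval a (q * X) = aeval a (X * q) := by rw [mul_comm]
    simpa using LinearMap.congr_fun h y
  refine ⟨a.restrict hinv, fun w => rfl, fun p => ?_⟩
  have hp : ∀ w, ((aeval (a.restrict hinv) p w : LinearMap.range (aeval a q)) : V) =
      aeval a p w := by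
    induction p using Polynomial.induction_on' with
    | add p₁ p₂ h₁ h₂ => intro w; simp [h₁, h₂]
    | monomial k t =>
      intro w
      simp only [aeval_monomial, Module.End.mul_apply, Module.algebraMap_end_apply,
        Submodule.coe_smul]
      congr 1
      induction k with
      | zero => simp
      | succ k ih => simp [pow_succ', ih]
  have hcomp : (LinearMap.range (aeval a q)).subtype ∘ₗ aeval (a.restrict hinv) p =
      aeval a p ∘ₗ (LinearMap.range (aeval a q)).subtype := LinearMap.ext hp
  rw [← Submodule.finrank_map_subtype_eq, ← LinearMap.range_comp, hcomp, LinearMap.range_comp,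
    Submodule.range_subtype, ← LinearMap.range_comp, map_mul, Module.End.mul_eq_comp]

open Polynomial in
/-- Two endomorphisms of finite-dimensional spaces whose polynomials have equal ranks are
isomorphic. -/
theorem exists_intertwining_equiv_of_finrank_range_aeval {K : Type*} [Field K] [IsAlgClosed K]
    (d : ℕ) : ∀ {V V' : Type*} [AddCommGroup V] [Module K V] [FiniteDimensional K V]
    [AddCommGroup V'] [Module K V'] [FiniteDimensional K V']
    (_ : Module.finrank K V = d) (a : Module.End K V) (b : Module.End K V')
    (_ : ∀ p : K[X], Module.finrank K (LinearMap.range (aeval a p)) =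
      Module.finrank K (LinearMap.range (aeval b p))),
    ∃ g : V ≃ₗ[K] V', ∀ v, g (a v) = b (g v) := by
  induction d using Nat.strong_induction_on with
  | _ d ih =>
  intro V V' _ _ _ _ _ _ hd a b hab
  have hdim : Module.finrank K V = Module.finrank K V' := by
    have h := hab 1
    rwa [map_one, map_one, Module.End.one_eq_id, Module.End.one_eq_id, LinearMap.range_id,
      LinearMap.range_id, finrank_top, finrank_top] at h
  rcases subsingleton_or_nontrivial V with hV | hV
  · exact ⟨LinearEquiv.ofFinrankEq _ _ hdim, fun v => by
      have : Subsingleton V' := (LinearEquiv.ofFinrankEq V V' hdim).symm.toEquiv.subsingleton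
      exact Subsingleton.elim _ _⟩
  obtain ⟨c, hc⟩ := Module.End.exists_eigenvalue a
  obtain ⟨r, hr, hrp⟩ := exists_restriction_range_aeval a (X - C c)
  obtain ⟨t, ht, htp⟩ := exists_restriction_range_aeval b (X - C c)
  have hlt : Module.finrank K (LinearMap.range (aeval a (X - C c))) < d := by
    obtain ⟨v, hv⟩ := hc.exists_hasEigenvector
    have h1 := (aeval a (X - C c)).finrank_range_add_finrank_ker
    have h2 : Module.finrank K (LinearMap.ker (aeval a (X - C c))) ≠ 0 := fun h0 => by
      have h3 : v ∈ LinearMap.ker (aeval a (X - C c)) := by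
        simp [hv.apply_eq_smul]
      rw [Submodule.finrank_eq_zero.1 h0] at h3
      exact hv.2 h3
    omega
  obtain ⟨f, hf⟩ := ih _ hlt rfl r t fun p => by rw [hrp, htp, hab]
  obtain ⟨g, hg⟩ := exists_intertwining_equiv_of_range hdim (aeval a (X - C c))
    (aeval b (X - C c)) f fun w => by
      have h : (aeval a (X - C c)).rangeRestrict (w : V) = r w - c • w :=
        Subtype.ext (by simp [hr])
      have h' : f (r w - c • w) = t (f w) - c • f w :=
        (map_sub f _ _).trans (congrArg₂ _ (hf w) (map_smul f c w))
      refine (congrArg (fun z => (f z : V')) h).trans ((congrArg Subtype.val h').trans ?_)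
      simp [ht]
  refine ⟨g, fun v => ?_⟩
  have h := hg v
  simpa using h

open Polynomial in
theorem range_aeval_eq_of_associated {K V : Type*} [Field K] [AddCommGroup V] [Module K V]
    (a : Module.End K V) {p q : K[X]} (h : Associated p q) :
    LinearMap.range (aeval a p) = LinearMap.range (aeval a q) := by
  obtain ⟨u, rfl⟩ := h
  have hu : IsUnit (aeval a (u : K[X])) := u.isUnit.map _
  rw [map_mul, Module.End.mul_eq_comp, LinearMap.range_comp_of_range_eq_top]
  exact LinearMap.range_eq_top.2 ((Module.End.isUnit_iff _).1 hu).2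

open Polynomial in
theorem finrank_ker_aeval_mul_of_isCoprime {K V : Type*} [Field K] [AddCommGroup V] [Module K V]
    [FiniteDimensional K V] (a : Module.End K V) {p q : K[X]} (h : IsCoprime p q) :
    Module.finrank K (LinearMap.ker (aeval a (p * q))) =
      Module.finrank K (LinearMap.ker (aeval a p)) +
        Module.finrank K (LinearMap.ker (aeval a q)) := by
  have h1 := Submodule.finrank_sup_add_finrank_inf_eq (LinearMap.ker (aeval a p))
    (LinearMap.ker (aeval a q))
  rwa [sup_ker_aeval_eq_ker_aeval_mul_of_coprime a h,
    (disjoint_ker_aeval_of_isCoprime a h).eq_bot, finrank_bot, add_zero] at h1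

open Polynomial in
/-- The ranks of the powers of `a - c` determine the rank of every polynomial in `a`. -/
theorem finrank_range_aeval_eq {K V V' : Type*} [Field K] [IsAlgClosed K]
    [AddCommGroup V] [Module K V] [FiniteDimensional K V]
    [AddCommGroup V'] [Module K V'] [FiniteDimensional K V']
    (a : Module.End K V) (b : Module.End K V') (hdim : Module.finrank K V = Module.finrank K V')
    (hab : ∀ (c : K) (k : ℕ), Module.finrank K (LinearMap.range (aeval a ((X - C c) ^ k))) =
      Module.finrank K (LinearMap.range (aeval b ((X - C c) ^ k)))) (p : K[X]) :
    Module.finrank K (LinearMap.range (aeval a p)) =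
      Module.finrank K (LinearMap.range (aeval b p)) := by
  induction p using UniqueFactorizationMonoid.induction_on_coprime with
  | h0 =>
    rw [map_zero, map_zero, LinearMap.range_zero, LinearMap.range_zero, finrank_bot, finrank_bot]
  | h1 hx =>
    rw [range_aeval_eq_of_associated a (associated_one_iff_isUnit.2 hx),
      range_aeval_eq_of_associated b (associated_one_iff_isUnit.2 hx)]
    have h := hab 0 0
    rwa [pow_zero] at h
  | hpr i hp =>
    rename_i p
    obtain ⟨c, hc⟩ := IsAlgClosed.exists_root p
      (fun h => hp.not_isUnit (isUnit_iff_degree_eq_zero.2 h))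
    have h := ((irreducible_X_sub_C c).associated_of_dvd hp.irreducible
      (dvd_iff_isRoot.2 hc)).symm.pow_pow (n := i)
    rw [range_aeval_eq_of_associated a h, range_aeval_eq_of_associated b h, hab]
  | hcp hxy hx hy =>
    rename_i x y
    have h := hxy.isCoprime
    have hA := finrank_ker_aeval_mul_of_isCoprime a h
    have hB := finrank_ker_aeval_mul_of_isCoprime b h
    have h1 := (aeval a x).finrank_range_add_finrank_ker
    have h2 := (aeval a y).finrank_range_add_finrank_ker
    have h3 := (aeval a (x * y)).finrank_range_add_finrank_ker
    have h4 := (aeval b x).finrank_range_add_finrank_ker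
    have h5 := (aeval b y).finrank_range_add_finrank_ker
    have h6 := (aeval b (x * y)).finrank_range_add_finrank_ker
    omega

open Polynomial in
/-- Complex matrices whose shifted powers have equal ranks are similar. -/
theorem exists_units_conj_of_rank_eq {n : ℕ} {M N : Matrix (Fin n) (Fin n) ℂ}
    (h : ∀ (c : ℂ) (k : ℕ), ((M - c • 1) ^ k).rank = ((N - c • 1) ^ k).rank) :
    ∃ P : (Matrix (Fin n) (Fin n) ℂ)ˣ, M = P * N * (↑P⁻¹ : Matrix (Fin n) (Fin n) ℂ) := by
  have hrank : ∀ (N : Matrix (Fin n) (Fin n) ℂ) (c : ℂ) (k : ℕ),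
      Module.finrank ℂ (LinearMap.range (aeval (toLinAlgEquiv' N) ((X - C c) ^ k))) =
        ((N - c • 1) ^ k).rank := by
    intro N c k
    have h : aeval (toLinAlgEquiv' N) ((X - C c) ^ k) = toLinAlgEquiv' ((N - c • 1) ^ k) := by
      simp [Algebra.algebraMap_eq_smul_one]
    rw [h]
    rfl
  obtain ⟨g, hg⟩ := exists_intertwining_equiv_of_finrank_range_aeval _ rfl
    (toLinAlgEquiv' N) (toLinAlgEquiv' M)
    (finrank_range_aeval_eq _ _ rfl fun c k => by rw [hrank, hrank, h])
  let P : (Matrix (Fin n) (Fin n) ℂ)ˣ :=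
    { val := LinearMap.toMatrixAlgEquiv' g.toLinearMap
      inv := LinearMap.toMatrixAlgEquiv' g.symm.toLinearMap
      val_inv := by
        rw [← LinearMap.toMatrixAlgEquiv'_comp]; simp
      inv_val := by
        rw [← LinearMap.toMatrixAlgEquiv'_comp]; simp }
  refine ⟨P, ?_⟩
  rw [Units.eq_mul_inv_iff_mul_eq]
  apply (toLinAlgEquiv' (R := ℂ) (n := Fin n)).injective
  refine LinearMap.ext fun v => ?_
  have hP : toLinAlgEquiv' (P : Matrix (Fin n) (Fin n) ℂ) = g.toLinearMap :=
    toLinAlgEquiv'_toMatrixAlgEquiv' _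
  rw [map_mul, map_mul, hP]
  exact (hg v).symm

theorem SameJordanType.symm {n : ℕ} {M N : Matrix (Fin n) (Fin n) ℂ} (h : SameJordanType n M N) :
    SameJordanType n N M := by
  obtain ⟨φ, hφ⟩ := h
  exact ⟨φ.symm, fun μ k => by rw [hφ, φ.apply_symm_apply]⟩

theorem SameJordanType.trans {n : ℕ} {M N L : Matrix (Fin n) (Fin n) ℂ}
    (h : SameJordanType n M N) (h' : SameJordanType n N L) : SameJordanType n M L := by
  obtain ⟨φ, hφ⟩ := h
  obtain ⟨ψ, hψ⟩ := h'
  exact ⟨φ.trans ψ, fun μ k => by rw [hφ, hψ]; rfl⟩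

theorem SameJordanType.units_conj {n : ℕ} (M : Matrix (Fin n) (Fin n) ℂ)
    (P : (Matrix (Fin n) (Fin n) ℂ)ˣ) :
    SameJordanType n (P * M * (↑P⁻¹ : Matrix (Fin n) (Fin n) ℂ)) M := by
  refine ⟨Equiv.setCongr spectrum.units_conjugate, fun μ k => ?_⟩
  have h : (P * M * (↑P⁻¹ : Matrix (Fin n) (Fin n) ℂ) - (μ : ℂ) • 1 : Matrix (Fin n) (Fin n) ℂ) =
      P * (M - (μ : ℂ) • 1) * (↑P⁻¹ : Matrix (Fin n) (Fin n) ℂ) := by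
    simp [mul_sub, sub_mul]
  rw [h, Units.conj_pow,
    rank_mul_eq_left_of_isUnit_det _ _ ((isUnit_iff_isUnit_det _).1 P⁻¹.isUnit),
    rank_mul_eq_right_of_isUnit_det _ _ ((isUnit_iff_isUnit_det _).1 P.isUnit)]
  rfl

open Polynomial in
/-- A polynomial that is injective and unramified on the spectrum preserves the ranks of the
shifted powers. -/
theorem rank_aeval_sub_pow {n : ℕ} {M : Matrix (Fin n) (Fin n) ℂ} {p : ℂ[X]}
    (hinj : Set.InjOn (fun z => p.eval z) (spectrum ℂ M))
    (hder : ∀ μ ∈ spectrum ℂ M, p.derivative.eval μ ≠ 0) {μ : ℂ} (hμ : μ ∈ spectrum ℂ M) (k : ℕ) :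
    ((aeval M p - p.eval μ • 1) ^ k).rank = ((M - μ • 1) ^ k).rank := by
  obtain ⟨r, hr⟩ := X_sub_C_dvd_sub_C_eval (a := μ) (p := p)
  have hr0 : ∀ ν ∈ spectrum ℂ M, r.eval ν ≠ 0 := by
    intro ν hν h0
    by_cases hνμ : ν = μ
    · subst hνμ
      have := congrArg (fun q => (derivative q).eval ν) hr
      simp [h0] at this
      exact hder ν hν this
    · have := congrArg (eval ν) hr
      simp [h0, sub_eq_zero] at this
      exact hνμ (hinj hν hμ this)
  have hunit : IsUnit (aeval M r) := by
    rw [← spectrum.zero_notMem_iff ℂ, spectrum.map_polynomial_aeval_of_nonempty M r ⟨μ, hμ⟩]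
    rintro ⟨ν, hν, h0⟩
    exact hr0 ν hν h0
  have hM := congrArg (aeval M) hr
  simp only [map_sub, map_mul, aeval_X, aeval_C, Algebra.algebraMap_eq_smul_one] at hM
  have hcomm : Commute (M - μ • 1) (aeval M r) := by
    have := congrArg (aeval M) (mul_comm (X - C μ) r)
    simpa [Algebra.algebraMap_eq_smul_one, commute_iff_eq] using this
  rw [hM, hcomm.mul_pow, rank_mul_eq_left_of_isUnit_det _ _
    ((isUnit_iff_isUnit_det _).1 (hunit.pow k))]

open Polynomial in
theorem SameJordanType.aeval {n : ℕ} (hn : 0 < n) {M : Matrix (Fin n) (Fin n) ℂ} {p : ℂ[X]}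
    (hinj : Set.InjOn (fun z => p.eval z) (spectrum ℂ M))
    (hder : ∀ μ ∈ spectrum ℂ M, p.derivative.eval μ ≠ 0) :
    SameJordanType n M (aeval M p) := by
  have : Nonempty (Fin n) := ⟨⟨0, hn⟩⟩
  have hsp := spectrum.map_polynomial_aeval_of_nonempty M p
    (spectrum.nonempty_of_isAlgClosed_of_finiteDimensional ℂ M)
  refine ⟨(hinj.bijOn_image.equiv _).trans (Equiv.setCongr hsp.symm), fun μ k => ?_⟩
  exact (rank_aeval_sub_pow hinj hder μ.2 k).symm

open Polynomial in
theorem exists_polynomial_eval_eq_derivative_ne_zero (s : Finset ℂ) (f : ℂ → ℂ) :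
    ∃ p : ℂ[X], ∀ x ∈ s, p.eval x = f x ∧ p.derivative.eval x ≠ 0 := by
  classical
  let r := Lagrange.interpolate s id f
  let w := Lagrange.nodal s (id : ℂ → ℂ)
  let c := Lagrange.interpolate s id
    fun x => (1 - r.derivative.eval x) / w.derivative.eval x
  have hid : Set.InjOn (id : ℂ → ℂ) s := Function.injective_id.injOn
  refine ⟨r + c * w, fun x hx => ?_⟩
  have hw : w.eval x = 0 := Lagrange.eval_nodal_at_node (v := id) hx
  have hw' : w.derivative.eval x ≠ 0 := by
    have := Lagrange.eval_nodal_derivative_eval_node_eq (v := (id : ℂ → ℂ)) hx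
    rw [id] at this
    rw [this, Lagrange.eval_nodal, Finset.prod_ne_zero_iff]
    intro y hy
    exact sub_ne_zero.2 (Finset.ne_of_mem_erase hy).symm
  have hr : r.eval x = f x := Lagrange.eval_interpolate_at_node f hid hx
  have hc : c.eval x = (1 - r.derivative.eval x) / w.derivative.eval x :=
    Lagrange.eval_interpolate_at_node (fun x => (1 - r.derivative.eval x) / w.derivative.eval x)
      hid hx
  refine ⟨by simp [hw, hr], ?_⟩
  have : (r + c * w).derivative.eval x = 1 := by
    simp only [derivative_add, derivative_mul, eval_add, eval_mul, hw, hc]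
    field_simp
    ring
  rw [this]
  exact one_ne_zero

open Polynomial in
theorem exists_continuous_dividedDifference (p : ℂ[X]) :
    ∃ q : ℂ × ℂ → ℂ, Continuous q ∧
      (∀ x y, q (x, y) * (x - y) = p.eval x - p.eval y) ∧
      ∀ x, q (x, x) = p.derivative.eval x := by
  refine ⟨fun z => ∑ k ∈ p.support, p.coeff k *
    ∑ i ∈ Finset.range k, z.1 ^ i * z.2 ^ (k - 1 - i), by fun_prop, fun x y => ?_, fun x => ?_⟩
  · rw [Finset.sum_mul, eval_eq_sum, eval_eq_sum, Polynomial.sum, Polynomial.sum,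
      ← Finset.sum_sub_distrib]
    refine Finset.sum_congr rfl fun k _ => ?_
    rw [mul_assoc, (Commute.all x y).geom_sum₂_mul, mul_sub]
  · simp [derivative_eval, Polynomial.sum, geom_sum₂_self, mul_assoc]

attribute [local instance] Matrix.linftyOpNormedRing Matrix.linftyOpNormedAlgebra in
theorem upperHemicontinuous_matrix_spectrum (n : ℕ) :
    UpperHemicontinuous (spectrum ℂ : Matrix (Fin n) (Fin n) ℂ → Set ℂ) :=
  upperHemicontinuous_spectrum ℂ (Matrix (Fin n) (Fin n) ℂ)

open Polynomial in
theorem eventually_injOn_spectrum {n : ℕ} {B : Matrix (Fin n) (Fin n) ℂ} {p : ℂ[X]}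
    (hinj : Set.InjOn (fun z => p.eval z) (spectrum ℂ B))
    (hder : ∀ μ ∈ spectrum ℂ B, p.derivative.eval μ ≠ 0) :
    ∀ᶠ M in nhds B, Set.InjOn (fun z => p.eval z) (spectrum ℂ M) ∧
      ∀ μ ∈ spectrum ℂ M, p.derivative.eval μ ≠ 0 := by
  obtain ⟨q, hq, hqd, hqs⟩ := exists_continuous_dividedDifference p
  have hc : IsCompact (spectrum ℂ B) := B.finite_spectrum.isCompact
  obtain ⟨u, v, hu, hv, hBu, hBv, huv⟩ := generalized_tube_lemma hc hc
    (isOpen_ne.preimage hq : IsOpen (q ⁻¹' {z | z ≠ 0})) (by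
      rintro ⟨x, y⟩ ⟨hx, hy⟩
      by_cases hxy : x = y
      · subst hxy
        simpa [hqs] using hder x hx
      · intro h0
        have := hqd x y
        rw [h0, zero_mul] at this
        exact hxy (hinj hx hy (sub_eq_zero.1 this.symm)))
  filter_upwards [(upperHemicontinuous_matrix_spectrum n).forall_isOpen B (u ∩ v) (hu.inter hv)
    (Set.subset_inter hBu hBv)] with M hM
  have hne : ∀ x ∈ spectrum ℂ M, ∀ y ∈ spectrum ℂ M, q (x, y) ≠ 0 := fun x hx y hy =>
    huv (Set.mk_mem_prod (hM hx).1 (hM hy).2)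
  refine ⟨fun x hx y hy hxy => ?_, fun x hx => hqs x ▸ hne x hx x hx⟩
  have := hqd x y
  rw [sub_eq_zero.2 hxy] at this
  exact sub_eq_zero.1 ((mul_eq_zero.1 this).resolve_left (hne x hx y hy))

theorem rank_sub_smul_pow_of_notMem_spectrum {n : ℕ} {M : Matrix (Fin n) (Fin n) ℂ} {c : ℂ}
    (hc : c ∉ spectrum ℂ M) (k : ℕ) : ((M - c • 1) ^ k).rank = n := by
  have h : IsUnit (M - c • 1) := by
    rw [spectrum.notMem_iff, Algebra.algebraMap_eq_smul_one] at hc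
    simpa using hc.neg
  simpa using rank_of_isUnit _ (h.pow k)

theorem bundle_closure_trans (n : ℕ) (hn : 0 < n) (A B C : Matrix (Fin n) (Fin n) ℂ)
    (hAB : A ∈ bundle n B) (hBC : B ∈ closure (bundle n C)) :
    A ∈ closure (bundle n C) := by
  classical
  have : Nonempty (Fin n) := ⟨⟨0, hn⟩⟩
  obtain ⟨φ, hφ⟩ := SameJordanType.symm hAB
  obtain ⟨p, hp⟩ := exists_polynomial_eval_eq_derivative_ne_zero B.finite_spectrum.toFinset
    fun x => if hx : x ∈ spectrum ℂ B then φ ⟨x, hx⟩ else 0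
  have hpφ : ∀ μ : spectrum ℂ B, p.eval (μ : ℂ) = φ μ := fun μ => by
    simpa using (hp μ (by simp)).1
  have hder : ∀ μ ∈ spectrum ℂ B, p.derivative.eval μ ≠ 0 := fun μ hμ =>
    (hp μ (by simpa using hμ)).2
  have hinj : Set.InjOn (fun z => p.eval z) (spectrum ℂ B) := by
    intro x hx y hy hxy
    have h : φ ⟨x, hx⟩ = φ ⟨y, hy⟩ := Subtype.ext (by
      rw [← hpφ, ← hpφ]; exact hxy)
    exact congrArg Subtype.val (φ.injective h)
  obtain ⟨P, hP⟩ : ∃ P : (Matrix (Fin n) (Fin n) ℂ)ˣ,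
      A = P * Polynomial.aeval B p * (↑P⁻¹ : Matrix (Fin n) (Fin n) ℂ) := by
    refine exists_units_conj_of_rank_eq fun c k => ?_
    by_cases hc : c ∈ spectrum ℂ A
    · obtain ⟨μ, hμ⟩ := φ.surjective ⟨c, hc⟩
      have hμc : p.eval (μ : ℂ) = c := by rw [hpφ, hμ]
      rw [← hμc, rank_aeval_sub_pow hinj hder μ.2, hφ, ← hpφ]
    · rw [rank_sub_smul_pow_of_notMem_spectrum hc, rank_sub_smul_pow_of_notMem_spectrum]
      rw [spectrum.map_polynomial_aeval_of_nonempty B p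
        (spectrum.nonempty_of_isAlgClosed_of_finiteDimensional ℂ B)]
      rintro ⟨μ, hμ, rfl⟩
      exact hc (by simp only [hpφ ⟨μ, hμ⟩]; exact (φ ⟨μ, hμ⟩).2)
  have hcont : Continuous fun M : Matrix (Fin n) (Fin n) ℂ =>
      (P * Polynomial.aeval M p * (↑P⁻¹ : Matrix (Fin n) (Fin n) ℂ) : Matrix (Fin n) (Fin n) ℂ) :=
    (continuous_const.mul p.continuous_aeval).mul continuous_const
  rw [hP]
  refine mem_closure_of_frequently_of_tendsto ?_ (hcont.tendsto B)
  refine ((mem_closure_iff_frequently.1 hBC).and_eventually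
    (eventually_injOn_spectrum hinj hder)).mono fun M ⟨hM, hMi, hMd⟩ => ?_
  exact ((SameJordanType.units_conj _ P).trans (SameJordanType.aeval hn hMi hMd).symm).trans hM
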